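/- arXiv:math/0607191 — 2 statements merged into one kernel-verified Lean document; each statement's English description precedes it below -/
import Mathlib

section
/- Let 1 ≤ n₁ ≤ ⋯ ≤ n_k with k ≥ 3, and suppose Π_{i=1}^{k-1}(n_i + 1) − Σ_{i=1}^{k-1} n_i < d < min{ Π_{i=1}^{k-1}(n_i + 1), n_k + 1 }. Then the Segre variety P^{n₁} × ⋯ × P^{n_k} has a defective d-secant variety; that is, T(n₁,…,n_k; d; 0,…,0) fails: for every choice of d points p₁,…,p_d, dim(Σ_{j=1}^d T_{p_j}) < min{ d(1 + Σ_{i=1}^k n_i), Π_{i=1}^k (n_i + 1) }. -/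
open scoped TensorProduct

/-- The subspace `G^i_p = v₁ ⊗ ⋯ ⊗ v_{i-1} ⊗ Vᵢ ⊗ v_{i+1} ⊗ ⋯ ⊗ v_k` of the tensor
space `⨂ᵢ K^{nᵢ+1}` attached to the point `p = v₁ ⊗ ⋯ ⊗ v_k`. -/
noncomputable def segreG (K : Type*) [Field K] {k : ℕ} (n : Fin k → ℕ)
    (v : ∀ i, Fin (n i + 1) → K) (i : Fin k) :
    Submodule K (⨂[K] i, (Fin (n i + 1) → K)) :=
  LinearMap.range ((PiTensorProduct.tprod K).toLinearMap v i)

/-- The affine tangent space `T_p = Σᵢ v₁ ⊗ ⋯ ⊗ Vᵢ ⊗ ⋯ ⊗ v_k` to the Segre variety at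
`p = v₁ ⊗ ⋯ ⊗ v_k`. -/
noncomputable def segreTangent (K : Type*) [Field K] {k : ℕ} (n : Fin k → ℕ)
    (v : ∀ i, Fin (n i + 1) → K) : Submodule K (⨂[K] i, (Fin (n i + 1) → K)) :=
  ⨆ i, segreG K n v i

/-- The statement `T(n₁,…,n_k; s; a₁,…,a_k)` of Abo–Ottaviani–Peterson holds:
there are points `p₁,…,p_s` and `q_{i,1},…,q_{i,aᵢ}` (pure tensors of nonzero vectors)
such that the span of the tangent spaces `T_{p_j}` together with the subspaces
`G^i_{q_{i,l}}` has the expected (maximal possible) dimension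
`min (s(1 + Σ nᵢ) + Σ aᵢ(nᵢ+1)) (Π (nᵢ+1))`. -/
def THolds (K : Type*) [Field K] {k : ℕ} (n : Fin k → ℕ) (s : ℕ) (a : Fin k → ℕ) : Prop :=
  ∃ (p : Fin s → ∀ i, Fin (n i + 1) → K)
    (q : ∀ i : Fin k, Fin (a i) → ∀ j, Fin (n j + 1) → K),
    (∀ j i, p j i ≠ 0) ∧ (∀ i l j, q i l j ≠ 0) ∧
    Module.finrank K
      (((⨆ j, segreTangent K n (p j)) ⊔ (⨆ i, ⨆ l, segreG K n (q i l) i))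
        : Submodule K (⨂[K] i, (Fin (n i + 1) → K)))
      = min (s * (1 + ∑ i, n i) + ∑ i, a i * (n i + 1)) (∏ i, (n i + 1))

/-- The statement `T(n₁,…,n_k; s; a₁,…,a_k)` fails: every choice of points gives a span
of dimension strictly smaller than the expected dimension. -/
def TFails (K : Type*) [Field K] {k : ℕ} (n : Fin k → ℕ) (s : ℕ) (a : Fin k → ℕ) : Prop :=
  ∀ (p : Fin s → ∀ i, Fin (n i + 1) → K)
    (q : ∀ i : Fin k, Fin (a i) → ∀ j, Fin (n j + 1) → K),
    (∀ j i, p j i ≠ 0) → (∀ i l j, q i l j ≠ 0) →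
    Module.finrank K
      (((⨆ j, segreTangent K n (p j)) ⊔ (⨆ i, ⨆ l, segreG K n (q i l) i))
        : Submodule K (⨂[K] i, (Fin (n i + 1) → K)))
      < min (s * (1 + ∑ i, n i) + ∑ i, a i * (n i + 1)) (∏ i, (n i + 1))

/-- The tuple `(n; s; a)` is subabundant. -/
def Subabundant {k : ℕ} (n : Fin k → ℕ) (s : ℕ) (a : Fin k → ℕ) : Prop :=
  s * (1 + ∑ i, n i) + ∑ i, a i * (n i + 1) ≤ ∏ i, (n i + 1)

/-- The tuple `(n; s; a)` is superabundant. -/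
def Superabundant {k : ℕ} (n : Fin k → ℕ) (s : ℕ) (a : Fin k → ℕ) : Prop :=
  ∏ i, (n i + 1) ≤ s * (1 + ∑ i, n i) + ∑ i, a i * (n i + 1)

section FinTensor

variable {K : Type*} [Field K] {m : ℕ} {V : Fin (m + 1) → Type*}
  [∀ i, AddCommGroup (V i)] [∀ i, Module K (V i)]

/-- The map from `⨂ᵢ Vᵢ` to `(⨂_{i < m} Vᵢ) / U ⊗ V_m / W` induced by splitting off the last
factor. -/
noncomputable def tensorQuotientMap (U : Submodule K (⨂[K] i : Fin m, V i.castSucc))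
    (W : Submodule K (V (Fin.last m))) :
    (⨂[K] i, V i) →ₗ[K] ((⨂[K] i : Fin m, V i.castSucc) ⧸ U) ⊗[K] (V (Fin.last m) ⧸ W) :=
  PiTensorProduct.lift
    (((TensorProduct.mk K _ _).compl₁₂ U.mkQ W.mkQ).compMultilinearMap
      (PiTensorProduct.tprod K)).uncurryRight

theorem tensorQuotientMap_tprod (U : Submodule K (⨂[K] i : Fin m, V i.castSucc))
    (W : Submodule K (V (Fin.last m))) (v : ∀ i, V i) :
    tensorQuotientMap U W (PiTensorProduct.tprod K v) =
      U.mkQ (PiTensorProduct.tprod K (Fin.init v)) ⊗ₜ[K] W.mkQ (v (Fin.last m)) := by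
  simp [tensorQuotientMap]

theorem tensorQuotientMap_surjective (U : Submodule K (⨂[K] i : Fin m, V i.castSucc))
    (W : Submodule K (V (Fin.last m))) :
    Function.Surjective (tensorQuotientMap U W) := by
  rw [← LinearMap.range_eq_top, eq_top_iff, ← TensorProduct.span_tmul_eq_top, Submodule.span_le]
  rintro _ ⟨a, b, rfl⟩
  obtain ⟨a, rfl⟩ := U.mkQ_surjective a
  obtain ⟨b, rfl⟩ := W.mkQ_surjective b
  have ha : a ∈ Submodule.span K (Set.range (PiTensorProduct.tprod K
      (s := fun i : Fin m => V i.castSucc))) := by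
    rw [PiTensorProduct.span_tprod_eq_top]
    trivial
  induction ha using Submodule.span_induction with
  | mem x hx =>
    obtain ⟨v, rfl⟩ := hx
    refine ⟨PiTensorProduct.tprod K (Fin.snoc v b), ?_⟩
    rw [tensorQuotientMap_tprod, Fin.init_snoc, Fin.snoc_last]
  | zero => simp
  | add x y _ _ hx hy =>
    rw [map_add, TensorProduct.add_tmul]
    exact add_mem hx hy
  | smul c x _ hx =>
    rw [map_smul, ← TensorProduct.smul_tmul']
    exact Submodule.smul_mem _ c hx

end FinTensor

theorem finrank_piTensorProduct_pi (K : Type*) [Field K] {k : ℕ} (n : Fin k → ℕ) :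
    Module.finrank K (⨂[K] i, (Fin (n i + 1) → K)) = ∏ i, (n i + 1) := by
  rw [Module.finrank_eq_card_basis (Basis.piTensorProduct fun i => Pi.basisFun K (Fin (n i + 1)))]
  simp

theorem segreTangent_le_ker (K : Type*) [Field K] {m : ℕ} (n : Fin (m + 1) → ℕ)
    (v : ∀ i, Fin (n i + 1) → K)
    (U : Submodule K (⨂[K] i : Fin m, (Fin (n i.castSucc + 1) → K)))
    (W : Submodule K (Fin (n (Fin.last m) + 1) → K))
    (hU : PiTensorProduct.tprod K (Fin.init v) ∈ U) (hW : v (Fin.last m) ∈ W) :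
    segreTangent K n v ≤
      LinearMap.ker (tensorQuotientMap (V := fun i => Fin (n i + 1) → K) U W) := by
  refine iSup_le fun i => ?_
  rintro _ ⟨x, rfl⟩
  rw [LinearMap.mem_ker, MultilinearMap.toLinearMap_apply, tensorQuotientMap_tprod]
  induction i using Fin.lastCases with
  | last =>
    rw [Fin.init_update_last, Submodule.mkQ_apply, (Submodule.Quotient.mk_eq_zero U).2 hU,
      TensorProduct.zero_tmul]
  | cast i =>
    rw [Function.update_of_ne (Fin.castSucc_lt_last i).ne', W.mkQ_apply,
      (Submodule.Quotient.mk_eq_zero W).2 hW, TensorProduct.tmul_zero]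

/-- With `P = ∏_{i < m} (nᵢ + 1)` and `Q = n_m + 1`, the span of `d` tangent spaces has codimension
at least `(P - d) (Q - d)` when `d ≤ P` and `d ≤ Q`. -/
theorem finrank_iSup_segreTangent_add_le (K : Type*) [Field K] {m d x y : ℕ}
    (n : Fin (m + 1) → ℕ) (p : Fin d → ∀ i, Fin (n i + 1) → K)
    (hx : ∏ i : Fin m, (n i.castSucc + 1) = d + x) (hy : n (Fin.last m) + 1 = d + y) :
    Module.finrank K (⨆ j, segreTangent K n (p j) : Submodule K _) + x * y ≤
      (d + x) * (d + y) := by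
  set U : Submodule K (⨂[K] i : Fin m, (Fin (n i.castSucc + 1) → K)) :=
    Submodule.span K (Set.range fun j => PiTensorProduct.tprod K (Fin.init (p j)))
  set W : Submodule K (Fin (n (Fin.last m) + 1) → K) :=
    Submodule.span K (Set.range fun j => p j (Fin.last m))
  have hle : (⨆ j, segreTangent K n (p j)) ≤
      LinearMap.ker (tensorQuotientMap (V := fun i => Fin (n i + 1) → K) U W) :=
    iSup_le fun j => segreTangent_le_ker K n (p j) U W
      (Submodule.subset_span ⟨j, rfl⟩) (Submodule.subset_span ⟨j, rfl⟩)
  have hT := Submodule.finrank_mono hle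
  have hker := LinearMap.finrank_range_add_finrank_ker
    (tensorQuotientMap (V := fun i => Fin (n i + 1) → K) U W)
  rw [LinearMap.range_eq_top.2 (tensorQuotientMap_surjective
      (V := fun i => Fin (n i + 1) → K) U W), finrank_top,
    Module.finrank_tensorProduct, finrank_piTensorProduct_pi, Fin.prod_univ_castSucc, hx] at hker
  have hU : Module.finrank K U ≤ d := (finrank_range_le_card _).trans_eq (Fintype.card_fin d)
  have hW : Module.finrank K W ≤ d := (finrank_range_le_card _).trans_eq (Fintype.card_fin d)
  have hUq := U.finrank_quotient_add_finrank
  have hWq := W.finrank_quotient_add_finrank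
  rw [finrank_piTensorProduct_pi K fun i : Fin m => n i.castSucc, hx] at hUq
  rw [Module.finrank_fin_fun] at hWq
  have hxy := Nat.mul_le_mul (show x ≤ Module.finrank K (_ ⧸ U) by omega)
    (show y ≤ Module.finrank K (_ ⧸ W) by omega)
  rw [← hy]
  omega

theorem sum_le_prod_add_one {ι : Type*} (s : Finset ι) (f : ι → ℕ) :
    ∑ i ∈ s, f i ≤ ∏ i ∈ s, (f i + 1) := by
  classical
  suffices h : ∑ i ∈ s, f i + 1 ≤ ∏ i ∈ s, (f i + 1) by omega
  induction s using Finset.induction_on with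
  | empty => simp
  | insert a s ha ih =>
    rw [Finset.sum_insert ha, Finset.prod_insert ha]
    nlinarith [Nat.zero_le (f a * ∑ i ∈ s, f i)]

theorem filter_val_add_one_lt_eq_map_castSucc (m : ℕ) :
    Finset.univ.filter (fun i : Fin (m + 1) => (i : ℕ) + 1 < m + 1) =
      Finset.univ.map Fin.castSuccEmb := by
  ext i
  induction i using Fin.lastCases <;> simp [Fin.ext_iff, Fin.exists_iff]

/-- unbalanced Segre varieties are defective.  Let `1 ≤ n₁ ≤ ⋯ ≤ n_k`,
`k ≥ 3`, and suppose `Π_{i<k-1}(nᵢ+1) − Σ_{i<k-1} nᵢ < d < min (Π_{i<k-1}(nᵢ+1)) (n_k + 1)`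
(the left inequality being written subtraction-free as `Π < d + Σ`).  Then
`T(n₁,…,n_k; d; 0,…,0)` fails, i.e. the `d`-secant variety of the Segre variety is
defective. -/
theorem unbalanced_defective
    (K : Type*) [Field K] [CharZero K] {k : ℕ} (hk : 3 ≤ k)
    (n : Fin k → ℕ) (hmono : Monotone n) (hpos : ∀ i, 1 ≤ n i) (d : ℕ)
    (hlow : ∏ i ∈ Finset.univ.filter (fun i : Fin k => (i : ℕ) + 1 < k), (n i + 1)
        < d + ∑ i ∈ Finset.univ.filter (fun i : Fin k => (i : ℕ) + 1 < k), n i)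
    (hupper₁ : d < ∏ i ∈ Finset.univ.filter (fun i : Fin k => (i : ℕ) + 1 < k), (n i + 1))
    (hupper₂ : d < n ⟨k - 1, by omega⟩ + 1) :
    TFails K n d (fun _ => 0) := by
  obtain ⟨m, rfl⟩ : ∃ m, k = m + 1 := ⟨k - 1, by omega⟩
  intro p q _ _
  rw [filter_val_add_one_lt_eq_map_castSucc, Finset.prod_map] at hlow hupper₁
  rw [Finset.sum_map] at hlow
  simp only [Fin.coe_castSuccEmb] at hlow hupper₁
  change d < n (Fin.last m) + 1 at hupper₂
  have hsum := sum_le_prod_add_one Finset.univ fun i : Fin m => n i.castSucc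
  obtain ⟨x, hx⟩ := Nat.exists_eq_add_of_le hupper₁.le
  obtain ⟨y, hy⟩ := Nat.exists_eq_add_of_le hupper₂.le
  have key := finrank_iSup_segreTangent_add_le K n p hx hy
  have hq : (⨆ i, ⨆ l, segreG K n (q i l) i) = ⊥ :=
    iSup_eq_bot.2 fun i => iSup_eq_bot.2 fun l => Fin.elim0 l
  rw [hq, sup_bot_eq]
  simp only [zero_mul, Finset.sum_const_zero, add_zero]
  rw [Fin.sum_univ_castSucc, Fin.prod_univ_castSucc, hx, hy]
  set S := ∑ i : Fin m, n i.castSucc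
  have hd : 0 < d := by omega
  have hx0 : 0 < x := by omega
  have hy0 : 0 < y := by omega
  have hxS : x < S := by omega
  have hQ : 1 + (S + n (Fin.last m)) = S + d + y := by omega
  rw [hQ]
  refine lt_min ?_ ?_
  · nlinarith [Nat.mul_lt_mul_of_pos_left hxS hd]
  · nlinarith [Nat.mul_pos hx0 hy0]
end

section
/- Let 1 ≤ n₁ ≤ ⋯ ≤ n_k be unbalanced, i.e. n_k − 1 ≥ Π_{i=1}^{k-1}(n_i + 1) − Σ_{i=1}^{k-1} n_i. Then T(n₁,…,n_k; s; 0,…,0) holds and is subabundant if and only if s ≤ Π_{i=1}^{k-1}(n_i + 1) − Σ_{i=1}^{k-1} n_i. -/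
open scoped TensorProduct

/-- The coordinates of the pure tensor `⨂ᵢ vᵢ` in the standard basis. -/
def segreCoord {R ι : Type*} [CommRing R] [Fintype ι] {n : ι → ℕ}
    (v : ∀ i, Fin (n i + 1) → R) (a : ∀ i, Fin (n i + 1)) : R :=
  ∏ i, v i (a i)

section Generic

variable {ι : Type*} {n : ι → ℕ}

/-- The multi-index whose only nonzero entry is `d.2 + 1`, in position `d.1`. -/
def axisIndex [DecidableEq ι] (d : Σ i, Fin (n i)) : ∀ i, Fin (n i + 1) :=
  Function.update (fun _ => 0) d.1 d.2.succ

theorem axisIndex_ne_zero [DecidableEq ι] (d : Σ i, Fin (n i)) : axisIndex d ≠ fun _ => 0 := by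
  intro h
  have := congrFun h d.1
  simp [axisIndex, Fin.succ_ne_zero] at this

theorem axisIndex_injective [DecidableEq ι] : Function.Injective (axisIndex (n := n)) := by
  rintro ⟨i, c⟩ ⟨i', c'⟩ h
  have h1 := congrFun h i
  by_cases hi : i = i'
  · subst hi
    simpa [axisIndex] using h1
  · simp [axisIndex, Function.update_of_ne hi, Fin.succ_ne_zero] at h1

theorem sum_add_one_le_prod_add_one [Fintype ι] [DecidableEq ι] (n : ι → ℕ) :
    ∑ i, n i + 1 ≤ ∏ i, (n i + 1) := by
  have hinj : Function.Injective
      (fun o : Option (Σ i, Fin (n i)) => o.elim (fun _ => 0) (axisIndex (n := n))) := by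
    rintro (_ | d) (_ | d') h
    · rfl
    · exact absurd h.symm (axisIndex_ne_zero d')
    · exact absurd h (axisIndex_ne_zero d)
    · exact congrArg some (axisIndex_injective h)
  simpa using Fintype.card_le_of_injective _ hinj

theorem segreCoord_single [Fintype ι] {R : Type*} [CommRing R] (a : ∀ i, Fin (n i + 1)) :
    segreCoord (fun i => (Pi.single (a i) 1 : Fin (n i + 1) → R)) = Pi.single a 1 := by
  ext b
  by_cases h : b = a
  · subst h
    simp [segreCoord]
  · obtain ⟨i, hi⟩ := Function.ne_iff.1 h
    rw [Pi.single_eq_of_ne h]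
    exact Finset.prod_eq_zero (Finset.mem_univ i) (by simp [hi])

theorem update_single_zero [DecidableEq ι] {R : Type*} [CommRing R] (d : Σ i, Fin (n i)) :
    Function.update (fun i => (Pi.single 0 1 : Fin (n i + 1) → R)) d.1 (Pi.single d.2.succ 1)
      = fun i => Pi.single (axisIndex d i) 1 := by
  ext i : 1
  by_cases h : i = d.1
  · subst h
    simp [axisIndex]
  · simp [axisIndex, Function.update_of_ne h]

/-- The coordinates of the points `v l`, followed by those of the tangent directions at `v j`. -/
def pointsAndDirections [Fintype ι] [DecidableEq ι] {R : Type*} [CommRing R] {s : ℕ}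
    (v : Fin s → ∀ i, Fin (n i + 1) → R) (j : Fin s) :
    Fin s ⊕ (Σ i, Fin (n i)) → (∀ i, Fin (n i + 1)) → R :=
  Sum.elim (fun l => segreCoord (v l))
    (fun d => segreCoord (Function.update (v j) d.1 (Pi.single d.2.succ 1)))

theorem pointsAndDirections_map [Fintype ι] [DecidableEq ι] {R S : Type*} [CommRing R] [CommRing S]
    (f : R →+* S) {s : ℕ}
    (v : Fin s → ∀ i, Fin (n i + 1) → R) (j : Fin s) (x : Fin s ⊕ (Σ i, Fin (n i)))
    (a : ∀ i, Fin (n i + 1)) :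
    f (pointsAndDirections v j x a)
      = pointsAndDirections (fun l i c => f (v l i c)) j x a := by
  rcases x with l | d
  · simp [pointsAndDirections, segreCoord]
  · simp only [pointsAndDirections, segreCoord, Sum.elim_inr, map_prod]
    refine Finset.prod_congr rfl fun i _ => ?_
    by_cases h : i = d.1
    · subst h
      simp [Pi.single_apply, apply_ite f]
    · simp [Function.update_of_ne h]

/-- Distinct multi-indices, none of them on an axis, such that the `j`-th one is zero. -/
theorem exists_injective_avoiding_axes [Fintype ι] [DecidableEq ι] {s : ℕ}
    (hs : s + ∑ i, n i ≤ ∏ i, (n i + 1)) (j : Fin s) :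
    ∃ θ : Fin s → ∀ i, Fin (n i + 1), θ j = (fun _ => 0) ∧
      Function.Injective (Sum.elim θ (axisIndex (n := n))) := by
  classical
  let C := {a : ∀ i, Fin (n i + 1) // a ∉ Set.range (axisIndex (n := n))}
  have hcard : Fintype.card (Fin s) ≤ Fintype.card C := by
    have h1 : Fintype.card C
        = Fintype.card (∀ i, Fin (n i + 1)) - Fintype.card (Set.range (axisIndex (n := n))) :=
      Fintype.card_subtype_compl _
    rw [h1, Set.card_range_of_injective axisIndex_injective]
    simp
    omega
  obtain ⟨g⟩ := Function.Embedding.nonempty_of_card_le hcard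
  let z : C := ⟨fun _ => 0, by rintro ⟨d, hd⟩; exact axisIndex_ne_zero d hd⟩
  refine ⟨fun l => (Equiv.swap (g j) z (g l)).1, by simp [z], ?_⟩
  refine Function.Injective.sumElim ?_ axisIndex_injective ?_
  · intro l l' h
    exact g.injective ((Equiv.swap _ _).injective (Subtype.ext h))
  · intro l d h
    exact (Equiv.swap (g j) z (g l)).2 ⟨d, h.symm⟩

theorem exists_linearIndependent_pointsAndDirections [Fintype ι] [DecidableEq ι]
    (K : Type*) [Field K] [Infinite K] {s : ℕ}
    (hs : s + ∑ i, n i ≤ ∏ i, (n i + 1)) :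
    ∃ v : Fin s → ∀ i, Fin (n i + 1) → K,
      ∀ j, LinearIndependent K (pointsAndDirections v j) := by
  classical
  choose θ hθ0 hθ using exists_injective_avoiding_axes (n := n) hs
  let X : Fin s → ∀ i, Fin (n i + 1) → MvPolynomial (Fin s × Σ i, Fin (n i + 1)) K :=
    fun l i c => MvPolynomial.X (l, ⟨i, c⟩)
  let minor (j : Fin s) : MvPolynomial (Fin s × Σ i, Fin (n i + 1)) K :=
    Matrix.det (Matrix.of fun x y => pointsAndDirections X j x (Sum.elim (θ j) axisIndex y))
  have eval_minor (v : Fin s → ∀ i, Fin (n i + 1) → K) (j : Fin s) :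
      MvPolynomial.eval (fun q => v q.1 q.2.1 q.2.2) (minor j)
        = Matrix.det (Matrix.of fun x y =>
            pointsAndDirections v j x (Sum.elim (θ j) axisIndex y)) := by
    rw [RingHom.map_det]
    congr 1
    ext x y
    simp [pointsAndDirections_map, X]
  have minor_ne_zero (j : Fin s) : minor j ≠ 0 := by
    intro h
    have h1 := eval_minor (fun l i => Pi.single (θ j l i) 1) j
    have h2 : (Matrix.of fun x y => pointsAndDirections
        (fun l i => (Pi.single (θ j l i) 1 : Fin (n i + 1) → K)) j x
          (Sum.elim (θ j) axisIndex y)) = 1 := by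
      ext x y
      have h3 : pointsAndDirections
          (fun l i => (Pi.single (θ j l i) 1 : Fin (n i + 1) → K)) j x
            = Pi.single (Sum.elim (θ j) axisIndex x) 1 := by
        rcases x with l | d
        · simp [pointsAndDirections, segreCoord_single]
        · simp [pointsAndDirections, hθ0, update_single_zero, segreCoord_single]
      simp [h3, Matrix.one_apply, Pi.single_apply, (hθ j).eq_iff, eq_comm]
    rw [h2, h] at h1
    simp at h1
  obtain ⟨t, ht⟩ : ∃ t, MvPolynomial.eval t (∏ j, minor j) ≠ 0 := by
    by_contra! h
    exact Finset.prod_ne_zero_iff.2 (fun j _ => minor_ne_zero j)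
      (MvPolynomial.funext fun t => by simpa using h t)
  refine ⟨fun l i c => t (l, ⟨i, c⟩), fun j => ?_⟩
  have hj : MvPolynomial.eval t (minor j) ≠ 0 := by
    rw [map_prod] at ht
    exact Finset.prod_ne_zero_iff.1 ht j (Finset.mem_univ j)
  rw [eval_minor (fun l i c => t (l, ⟨i, c⟩)) j] at hj
  have hli := Matrix.linearIndependent_rows_of_det_ne_zero hj
  exact LinearIndependent.of_comp
    (LinearMap.funLeft K K (Sum.elim (θ j) (axisIndex (n := n)))) hli

end Generic

section Tangent

open Module

variable {K : Type*} [Field K]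

/-- Tensors in `⨂ᵢ K^{nᵢ+1}` as arrays of coordinates. -/
noncomputable def tensorCoord (K : Type*) [Field K] {k : ℕ} (n : Fin k → ℕ) :
    (⨂[K] i, (Fin (n i + 1) → K)) ≃ₗ[K] ((∀ i, Fin (n i + 1)) → K) :=
  (Basis.piTensorProduct fun i => Pi.basisFun K (Fin (n i + 1))).equivFun

theorem tensorCoord_tprod {k : ℕ} {n : Fin k → ℕ} (v : ∀ i, Fin (n i + 1) → K) :
    tensorCoord K n (PiTensorProduct.tprod K v) = segreCoord v := by
  ext a
  simp [tensorCoord, segreCoord, Basis.piTensorProduct_repr_tprod_apply]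

instance {k : ℕ} (n : Fin k → ℕ) : FiniteDimensional K (⨂[K] i, (Fin (n i + 1) → K)) :=
  Module.Finite.equiv (tensorCoord K n).symm

theorem tprod_ne_zero {k : ℕ} {n : Fin k → ℕ} {v : ∀ i, Fin (n i + 1) → K} (hv : ∀ i, v i ≠ 0) :
    PiTensorProduct.tprod K v ≠ 0 := by
  intro h
  choose a ha using fun i => Function.ne_iff.1 (hv i)
  have h1 := congrFun (tensorCoord_tprod v) a
  rw [h, map_zero] at h1
  exact Finset.prod_ne_zero_iff.2 (fun i _ => ha i) h1.symm

theorem tprod_update_mem_segreTangent {k : ℕ} {n : Fin k → ℕ} (v : ∀ i, Fin (n i + 1) → K)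
    (i : Fin k) (x : Fin (n i + 1) → K) :
    PiTensorProduct.tprod K (Function.update v i x) ∈ segreTangent K n v :=
  le_iSup (segreG K n v) i ⟨x, rfl⟩

theorem finrank_segreTangent_le {k : ℕ} {n : Fin k → ℕ} {v : ∀ i, Fin (n i + 1) → K}
    (hv : ∀ i, v i ≠ 0) : finrank K (segreTangent K n v) ≤ 1 + ∑ i, n i := by
  let p := PiTensorProduct.tprod K v
  have key (I : Finset (Fin k)) :
      finrank K ((K ∙ p) ⊔ ⨆ i ∈ I, segreG K n v i : Submodule K _) ≤ 1 + ∑ i ∈ I, n i := by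
    induction I using Finset.induction_on with
    | empty =>
      exact (Submodule.finrank_mono (t := K ∙ p) (by simp)).trans
        (finrank_span_singleton (tprod_ne_zero hv)).le
    | insert i I hi ih =>
      rw [Finset.iSup_insert, sup_left_comm, Finset.sum_insert hi]
      set A := (K ∙ p) ⊔ ⨆ i ∈ I, segreG K n v i
      have h1 := Submodule.finrank_sup_add_finrank_inf_eq (segreG K n v i) A
      have h2 : finrank K (segreG K n v i) ≤ n i + 1 :=
        (LinearMap.finrank_range_le ((PiTensorProduct.tprod K).toLinearMap v i)).trans_eq (by simp)
      have h3 : 1 ≤ finrank K (segreG K n v i ⊓ A : Submodule K _) := by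
        refine (finrank_span_singleton (K := K) (tprod_ne_zero hv)).symm.trans_le
          (Submodule.finrank_mono (le_inf ?_ le_sup_left))
        rw [Submodule.span_singleton_le_iff_mem]
        exact ⟨v i, by simp⟩
      omega
  refine (Submodule.finrank_mono ?_).trans (key Finset.univ)
  simp [segreTangent]

theorem finrank_iSup_segreTangent_le {k : ℕ} {n : Fin k → ℕ} {s : ℕ}
    {p : Fin s → ∀ i, Fin (n i + 1) → K} (hp : ∀ j i, p j i ≠ 0) :
    finrank K (⨆ j, segreTangent K n (p j) : Submodule K _) ≤ s * (1 + ∑ i, n i) := by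
  have key (I : Finset (Fin s)) :
      finrank K (⨆ j ∈ I, segreTangent K n (p j) : Submodule K _) ≤ I.card * (1 + ∑ i, n i) := by
    induction I using Finset.induction_on with
    | empty => simp
    | insert j I hj ih =>
      rw [Finset.iSup_insert, Finset.card_insert_of_notMem hj, add_mul, one_mul, add_comm]
      exact (Submodule.finrank_add_le_finrank_add_finrank _ _).trans
        (add_le_add (finrank_segreTangent_le (hp j)) ih)
  exact (Submodule.finrank_mono (by simp)).trans ((key Finset.univ).trans_eq (by simp))

section Last

variable {m : ℕ} {n : Fin (m + 1) → ℕ}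

theorem segreCoord_eq_init_mul_last (v : ∀ i, Fin (n i + 1) → K) (a : ∀ i, Fin (n i + 1)) :
    segreCoord v a = segreCoord (n := fun i : Fin m => n i.castSucc) (fun i => v i.castSucc)
      (fun i => a i.castSucc) * v (Fin.last m) (a (Fin.last m)) :=
  Fin.prod_univ_castSucc _

theorem segreCoord_update_last (v : ∀ i, Fin (n i + 1) → K) (x : Fin (n (Fin.last m) + 1) → K)
    (a : ∀ i, Fin (n i + 1)) :
    segreCoord (Function.update v (Fin.last m) x) a
      = segreCoord (n := fun i : Fin m => n i.castSucc) (fun i => v i.castSucc)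
        (fun i => a i.castSucc) * x (a (Fin.last m)) := by
  simp [segreCoord_eq_init_mul_last, Fin.castSucc_ne_last]

theorem segreCoord_update_castSucc (v : ∀ i, Fin (n i + 1) → K) (i : Fin m)
    (x : Fin (n i.castSucc + 1) → K) (a : ∀ i, Fin (n i + 1)) :
    segreCoord (Function.update v i.castSucc x) a
      = segreCoord (n := fun i : Fin m => n i.castSucc)
          (Function.update (fun i => v i.castSucc) i x)
        (fun i => a i.castSucc) * v (Fin.last m) (a (Fin.last m)) := by
  have h : (fun l : Fin m => Function.update v i.castSucc x l.castSucc)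
      = Function.update (fun i => v i.castSucc) i x := by
    ext l : 1
    by_cases hl : l = i
    · subst hl
      simp
    · simp [hl]
  rw [segreCoord_eq_init_mul_last, h, Function.update_of_ne (Fin.castSucc_ne_last i).symm]

/-- If the last components of `t` points span a space of dimension `r`, then their tangent spaces
lie in a space of dimension at most `(∏ i < m, (nᵢ + 1)) r + t (n_m + 1 - r)`. -/
theorem exists_finrank_iSup_segreTangent_le {t : ℕ} (p : Fin t → ∀ i, Fin (n i + 1) → K) :
    ∃ r c : ℕ, r ≤ t ∧ r + c = n (Fin.last m) + 1 ∧
      finrank K (⨆ j, segreTangent K n (p j) : Submodule K _)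
        ≤ (∏ i : Fin m, (n i.castSucc + 1)) * r + t * c := by
  let W := Submodule.span K (Set.range fun j => p j (Fin.last m))
  obtain ⟨C, hC⟩ := W.exists_isCompl
  let u (j : Fin t) (b : ∀ i : Fin m, Fin (n i.castSucc + 1)) : K :=
    segreCoord (n := fun i : Fin m => n i.castSucc) (fun i => p j i.castSucc) b
  let Φ : (((∀ i : Fin m, Fin (n i.castSucc + 1)) → W) × (Fin t → C)) →ₗ[K]
      ((∀ i, Fin (n i + 1)) → K) :=
    { toFun := fun gh a => (gh.1 fun i => a i.castSucc : Fin (n (Fin.last m) + 1) → K)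
          (a (Fin.last m))
        + ∑ j, u j (fun i => a i.castSucc)
          * (gh.2 j : Fin (n (Fin.last m) + 1) → K) (a (Fin.last m))
      map_add' := by
        intro x y
        ext a
        simp [mul_add, Finset.sum_add_distrib]
        ring
      map_smul' := by
        intro c x
        ext a
        simp [mul_add, Finset.mul_sum, mul_left_comm] }
  refine ⟨finrank K W, finrank K C, ?_, ?_, ?_⟩
  · exact (finrank_range_le_card fun j => p j (Fin.last m)).trans_eq (by simp)
  · simpa using Submodule.finrank_add_eq_of_isCompl hC
  · have hle : (⨆ j, segreTangent K n (p j)).map (tensorCoord K n).toLinearMap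
        ≤ LinearMap.range Φ := by
      rw [Submodule.map_le_iff_le_comap]
      refine iSup_le fun j => iSup_le fun i => ?_
      rintro _ ⟨x, rfl⟩
      rw [Submodule.mem_comap]
      change tensorCoord K n (PiTensorProduct.tprod K (Function.update (p j) i x)) ∈ _
      rw [tensorCoord_tprod]
      induction i using Fin.lastCases with
      | last =>
        obtain ⟨w, hw, c, hc, rfl⟩ := Submodule.mem_sup.1
          (hC.sup_eq_top ▸ Submodule.mem_top : x ∈ W ⊔ C)
        refine ⟨(fun b => u j b • ⟨w, hw⟩, Pi.single j ⟨c, hc⟩), ?_⟩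
        ext a
        rw [segreCoord_update_last]
        simp only [Φ, LinearMap.coe_mk, AddHom.coe_mk]
        rw [Finset.sum_eq_single j (by intro l _ hl; simp [hl]) (by simp)]
        simp [u, mul_add]
      | cast i =>
        refine ⟨(fun b => segreCoord (n := fun i : Fin m => n i.castSucc)
          (Function.update (fun i => p j i.castSucc) i x) b
            • ⟨p j (Fin.last m), Submodule.subset_span ⟨j, rfl⟩⟩, 0), ?_⟩
        ext a
        rw [segreCoord_update_castSucc]
        simp [Φ]
    have h1 := (Submodule.finrank_mono hle).trans (LinearMap.finrank_range_le Φ)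
    have h2 := LinearEquiv.finrank_map_eq (tensorCoord K n) (⨆ j, segreTangent K n (p j))
    simpa [Module.finrank_prod, Module.finrank_pi_fintype] using h2.symm.trans_le h1

/-- Points in the first `m` factors, independent together with the tangent directions at each of
them, extended by distinct basis vectors in the last factor have independent tangent spaces. -/
theorem le_finrank_iSup_segreTangent {s : ℕ}
    {v : Fin s → ∀ i : Fin m, Fin (n i.castSucc + 1) → K}
    (hv : ∀ j, LinearIndependent K (pointsAndDirections (n := fun i : Fin m => n i.castSucc) v j))
    {e : Fin s → Fin (n (Fin.last m) + 1)} (he : Function.Injective e) :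
    s * (1 + ∑ i, n i) ≤ finrank K (⨆ j, segreTangent K n
      (Fin.snoc (α := fun i => Fin (n i + 1) → K) (v j) (Pi.single (e j) 1)) : Submodule K _) := by
  let p (j : Fin s) : ∀ i, Fin (n i + 1) → K :=
    Fin.snoc (α := fun i => Fin (n i + 1) → K) (v j) (Pi.single (e j) 1)
  let D := Σ i : Fin m, Fin (n i.castSucc)
  let F : (Fin s × Fin (n (Fin.last m) + 1)) ⊕ (Fin s × D) →
      (⨂[K] i, (Fin (n i + 1) → K)) := Sum.elim
    (fun x => PiTensorProduct.tprod K (Function.update (p x.1) (Fin.last m) (Pi.single x.2 1)))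
    (fun x => PiTensorProduct.tprod K
      (Function.update (p x.1) x.2.1.castSucc (Pi.single x.2.2.succ 1)))
  have hF : LinearIndependent K F := by
    rw [Fintype.linearIndependent_iff]
    intro g hg
    have slice (l : Fin (n (Fin.last m) + 1)) (b : ∀ i : Fin m, Fin (n i.castSucc + 1)) :
        ∑ j, g (Sum.inl (j, l)) * segreCoord (n := fun i : Fin m => n i.castSucc) (v j) b
          + ∑ j, (if l = e j then ∑ d : D, g (Sum.inr (j, d))
            * pointsAndDirections (n := fun i : Fin m => n i.castSucc) v j (Sum.inr d) b else 0)
          = 0 := by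
      have h := congrFun (congrArg (tensorCoord K n) hg)
        (Fin.snoc (α := fun i => Fin (n i + 1)) b l)
      simpa [F, p, Fintype.sum_sum_type, Fintype.sum_prod_type, tensorCoord_tprod,
        segreCoord_update_last, segreCoord_update_castSucc, Pi.single_apply,
        pointsAndDirections, Finset.sum_ite_irrel] using h
    have hinr (j : Fin s) (d : D) : g (Sum.inr (j, d)) = 0 := by
      refine Fintype.linearIndependent_iff.1 (hv j)
        (Sum.elim (fun l => g (Sum.inl (l, e j))) (fun d => g (Sum.inr (j, d)))) ?_ (Sum.inr d)
      ext b
      have h := slice (e j) b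
      simp only [he.eq_iff, Finset.sum_ite_eq, Finset.mem_univ, if_true] at h
      simpa [Fintype.sum_sum_type, pointsAndDirections] using h
    have hinl (j : Fin s) (l : Fin (n (Fin.last m) + 1)) : g (Sum.inl (j, l)) = 0 := by
      refine Fintype.linearIndependent_iff.1 ((hv j).comp Sum.inl Sum.inl_injective)
        (fun j => g (Sum.inl (j, l))) ?_ j
      ext b
      simpa [hinr, pointsAndDirections] using slice l b
    rintro (⟨j, l⟩ | ⟨j, d⟩)
    · exact hinl j l
    · exact hinr j d
  have hspan : Submodule.span K (Set.range F) ≤ ⨆ j, segreTangent K n (p j) := by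
    rw [Submodule.span_le]
    rintro _ ⟨x | x, rfl⟩
    · exact le_iSup (fun j => segreTangent K n (p j)) x.1 (tprod_update_mem_segreTangent _ _ _)
    · exact le_iSup (fun j => segreTangent K n (p j)) x.1 (tprod_update_mem_segreTangent _ _ _)
  refine le_trans (le_of_eq ?_) (Submodule.finrank_mono hspan)
  rw [finrank_span_eq_card hF, Fin.sum_univ_castSucc]
  simp [D]
  ring

end Last

end Tangent

theorem THolds_zero_iff {K : Type*} [Field K] {k : ℕ} {n : Fin k → ℕ} {s : ℕ}
    (hs : Subabundant n s fun _ => 0) :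
    THolds K n s (fun _ => 0) ↔ ∃ p : Fin s → ∀ i, Fin (n i + 1) → K, (∀ j i, p j i ≠ 0) ∧
      Module.finrank K (⨆ j, segreTangent K n (p j) : Submodule K _) = s * (1 + ∑ i, n i) := by
  have h0 : min (s * (1 + ∑ i, n i) + ∑ i : Fin k, 0 * (n i + 1)) (∏ i, (n i + 1))
      = s * (1 + ∑ i, n i) := by
    rw [min_eq_left hs]
    simp
  have hq (p : Fin s → ∀ i, Fin (n i + 1) → K) (q : ∀ i : Fin k, Fin 0 → ∀ j, Fin (n j + 1) → K) :
      (⨆ j, segreTangent K n (p j)) ⊔ (⨆ i, ⨆ l, segreG K n (q i l) i)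
        = ⨆ j, segreTangent K n (p j) :=
    sup_eq_left.2 (iSup_le fun i => iSup_le fun l => l.elim0)
  unfold THolds
  rw [h0]
  constructor
  · rintro ⟨p, q, hp, -, h⟩
    exact ⟨p, hp,
      (congrArg (fun U : Submodule K _ => Module.finrank K U) (hq p q)).symm.trans h⟩
  · rintro ⟨p, hp, h⟩
    exact ⟨p, fun _ l => l.elim0, hp, fun _ l => l.elim0,
      (congrArg (fun U : Submodule K _ => Module.finrank K U) (hq p _)).trans h⟩

/-- A subabundant family of independent tangent spaces has at most
`∏ i < m, (nᵢ + 1) - ∑ i < m, nᵢ` members. -/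
theorem add_sum_le_prod_of_finrank_eq {K : Type*} [Field K] {m : ℕ} {n : Fin (m + 1) → ℕ} {s : ℕ}
    (hn : 1 ≤ ∑ i : Fin m, n i.castSucc)
    {p : Fin s → ∀ i, Fin (n i + 1) → K} (hp : ∀ j i, p j i ≠ 0)
    (hrank : Module.finrank K (⨆ j, segreTangent K n (p j) : Submodule K _)
      = s * (1 + ∑ i, n i)) :
    s + ∑ i : Fin m, n i.castSucc ≤ ∏ i : Fin m, (n i.castSucc + 1) := by
  by_contra! hlt
  have hSP := sum_add_one_le_prod_add_one fun i : Fin m => n i.castSucc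
  set S := ∑ i : Fin m, n i.castSucc with hS
  set P := ∏ i : Fin m, (n i.castSucc + 1)
  obtain ⟨t, ht⟩ : ∃ t, t + S = P + 1 := ⟨P + 1 - S, by omega⟩
  obtain ⟨u, rfl⟩ : ∃ u, s = t + u := ⟨s - t, by omega⟩
  obtain ⟨r, c, hrt, hrc, hr⟩ :=
    exists_finrank_iSup_segreTangent_le fun j : Fin t => p (Fin.castAdd u j)
  have hu := finrank_iSup_segreTangent_le (p := fun j : Fin u => p (Fin.natAdd t j))
    fun j i => hp _ i
  have hle : (⨆ j, segreTangent K n (p j)) ≤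
      (⨆ j : Fin t, segreTangent K n (p (Fin.castAdd u j)))
        ⊔ ⨆ j : Fin u, segreTangent K n (p (Fin.natAdd t j)) := by
    refine iSup_le fun j => ?_
    induction j using Fin.addCases with
    | left j =>
      exact le_sup_of_le_left (le_iSup (fun j => segreTangent K n (p (Fin.castAdd u j))) j)
    | right j =>
      exact le_sup_of_le_right (le_iSup (fun j => segreTangent K n (p (Fin.natAdd t j))) j)
  have htot := (Submodule.finrank_mono hle).trans
    (Submodule.finrank_add_le_finrank_add_finrank _ _)
  have hsum : 1 + ∑ i, n i = S + (r + c) := by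
    rw [Fin.sum_univ_castSucc, hrc, hS]
    ring
  rw [hrank, hsum] at htot
  rw [hsum] at hu
  change _ ≤ P * r + t * c at hr
  have h1 : t * S + t * r ≤ P * r := by nlinarith
  obtain ⟨d, hd⟩ : ∃ d, P = t + d := ⟨P - t, by omega⟩
  have h2 : t * S ≤ t * d := by
    have := Nat.mul_le_mul_left d hrt
    rw [hd] at h1
    nlinarith
  have h3 : S ≤ d := Nat.le_of_mul_le_mul_left h2 (by omega)
  omega

/-- Let `1 ≤ n₁ ≤ ⋯ ≤ n_k` be unbalanced, i.e.
`Π_{i<k-1}(nᵢ+1) + 1 ≤ n_k + Σ_{i<k-1} nᵢ` (a subtraction-free form of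
`n_k − 1 ≥ Π_{i<k-1}(nᵢ+1) − Σ_{i<k-1} nᵢ`).  Then `T(n; s; 0,…,0)` holds and is
subabundant if and only if `s + Σ_{i<k-1} nᵢ ≤ Π_{i<k-1}(nᵢ+1)` (a subtraction-free
form of `s ≤ Π_{i<k-1}(nᵢ+1) − Σ_{i<k-1} nᵢ`). -/
theorem unbalanced_THolds_iff
    (K : Type*) [Field K] [CharZero K] {k : ℕ} (hk : 3 ≤ k)
    (n : Fin k → ℕ) (hmono : Monotone n) (hpos : ∀ i, 1 ≤ n i)
    (hunbal : ∏ i ∈ Finset.univ.filter (fun i : Fin k => (i : ℕ) + 1 < k), (n i + 1) + 1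
        ≤ n ⟨k - 1, by omega⟩
          + ∑ i ∈ Finset.univ.filter (fun i : Fin k => (i : ℕ) + 1 < k), n i)
    (s : ℕ) :
    (THolds K n s (fun _ => 0) ∧ Subabundant n s (fun _ => 0)) ↔
    s + ∑ i ∈ Finset.univ.filter (fun i : Fin k => (i : ℕ) + 1 < k), n i
      ≤ ∏ i ∈ Finset.univ.filter (fun i : Fin k => (i : ℕ) + 1 < k), (n i + 1) := by
  obtain ⟨m, rfl⟩ : ∃ m, k = m + 1 := ⟨k - 1, by omega⟩
  have hsum : ∑ i ∈ Finset.univ.filter (fun i : Fin (m + 1) => (i : ℕ) + 1 < m + 1), n i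
      = ∑ i : Fin m, n i.castSucc := by
    simp [Finset.sum_filter, Fin.sum_univ_castSucc]
  have hprod : ∏ i ∈ Finset.univ.filter (fun i : Fin (m + 1) => (i : ℕ) + 1 < m + 1), (n i + 1)
      = ∏ i : Fin m, (n i.castSucc + 1) := by
    simp [Finset.prod_filter, Fin.prod_univ_castSucc]
  have hlast : (⟨m + 1 - 1, by omega⟩ : Fin (m + 1)) = Fin.last m := rfl
  rw [hsum, hprod, hlast] at hunbal
  rw [hsum, hprod]
  constructor
  · rintro ⟨hT, hsub⟩
    obtain ⟨p, hp, hrank⟩ := (THolds_zero_iff hsub).1 hT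
    refine add_sum_le_prod_of_finrank_eq ?_ hp hrank
    exact (hpos _).trans (Finset.single_le_sum (f := fun i : Fin m => n i.castSucc)
      (fun _ _ => Nat.zero_le _) (Finset.mem_univ ⟨0, by omega⟩))
  · intro hs
    have hsub : Subabundant n s fun _ => 0 := by
      unfold Subabundant
      rw [Fin.sum_univ_castSucc, Fin.prod_univ_castSucc]
      simp only [zero_mul, Finset.sum_const_zero, add_zero]
      obtain ⟨d, hd⟩ := Nat.exists_eq_add_of_le hs
      obtain ⟨e, he⟩ : ∃ e, n (Fin.last m) = s + d + 1 + e :=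
        ⟨n (Fin.last m) - (s + d + 1), by omega⟩
      rw [hd, he]
      exact Nat.le.intro
        (k := (∑ i : Fin m, n i.castSucc) * (d + 2 + e) + d * (s + d + 2 + e)) (by ring)
    refine ⟨(THolds_zero_iff hsub).2 ?_, hsub⟩
    obtain ⟨v, hv⟩ := exists_linearIndependent_pointsAndDirections K hs
    have hv0 (j : Fin s) (i : Fin m) : v j i ≠ 0 := by
      intro h
      refine (hv j).ne_zero (Sum.inl j) ?_
      ext a
      exact Finset.prod_eq_zero (Finset.mem_univ i) (by simp [h])
    have hp (j : Fin s) (i : Fin (m + 1)) :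
        Fin.snoc (α := fun i => Fin (n i + 1) → K) (v j)
          (Pi.single (Fin.castLE (by omega) j) 1) i ≠ 0 := by
      induction i using Fin.lastCases with
      | last => simp
      | cast i => simpa using hv0 j i
    exact ⟨_, hp, le_antisymm (finrank_iSup_segreTangent_le hp)
      (le_finrank_iSup_segreTangent hv (Fin.castLE_injective _))⟩
end
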